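/- arXiv:1006.2795 — 2 statements merged into one kernel-verified Lean document; each statement's English description precedes it below -/
import Mathlib

section
/- Let E be a pseudo-effect algebra and let c₁, c₂, …, cₙ be pairwise disjoint central elements of E (cᵢ ∧ cⱼ = 0 for i ≠ j) with c₁ + c₂ + ⋯ + cₙ = 1. Let X := E[0,c₁] × E[0,c₂] × ⋯ × E[0,cₙ] and define Φ : X → E by Φ(e₁,…,eₙ) := e₁ + e₂ + ⋯ + eₙ. Then (i) Φ is a PEA-isomorphism of X onto E, and (ii) for every e ∈ E, Φ⁻¹(e) = (e ∧ c₁, e ∧ c₂, …, e ∧ cₙ). -/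
namespace PEApaper

/-- The bare data of a partial-addition structure: a partial binary operation
(encoded via `Option`) together with constants `0` and `1`. -/
structure PartialStruct (E : Type) where
  padd : E → E → Option E
  zero : E
  one : E

namespace PartialStruct

variable {E : Type}

/-- `a ≤ b` iff `a + c = b` for some `c`. -/
def le (P : PartialStruct E) (a b : E) : Prop := ∃ c, P.padd a c = some b

/-- `m` is the greatest lower bound (meet `a ∧ b`) of `a` and `b`. -/
def IsMeet (P : PartialStruct E) (a b m : E) : Prop :=
  P.le m a ∧ P.le m b ∧ ∀ x, P.le x a → P.le x b → P.le x m

/-- `j` is the least upper bound (join `a ∨ b`) of `a` and `b`. -/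
def IsJoin (P : PartialStruct E) (a b j : E) : Prop :=
  P.le a j ∧ P.le b j ∧ ∀ x, P.le a x → P.le b x → P.le j x

/-- `s` is the supremum of the set `S`. -/
def IsSup (P : PartialStruct E) (S : Set E) (s : E) : Prop :=
  (∀ x ∈ S, P.le x s) ∧ ∀ u, (∀ x ∈ S, P.le x u) → P.le s u

/-- Left-associated partial sum of a list, continuing from `acc`. -/
def IsSumFrom (P : PartialStruct E) : E → List E → E → Prop
  | acc, [], s => s = acc
  | acc, a :: l, s => ∃ t, P.padd acc a = some t ∧ IsSumFrom P t l s

/-- `s` is the (left-associated) orthosum `e₁ + e₂ + ⋯ + eₙ` of the list. -/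
def IsSumList (P : PartialStruct E) (l : List E) (s : E) : Prop :=
  match l with
  | [] => s = P.zero
  | a :: t => IsSumFrom P a t s

/-- `c` is a central element: there is a PEA-isomorphism
`f : E → E[0,c] × E[0,c∼]` with `f c = (c,0)` such that `f x = (x₁,x₂)`
implies `x = x₁ + x₂`.  The isomorphism onto the product of the two
interval pseudo-effect algebras is spelled out explicitly. -/
def IsCentral (P : PartialStruct E) (c : E) : Prop :=
  ∃ cs, P.padd c cs = some P.one ∧
    ∃ f : E → E × E,
      (∀ x, P.le (f x).1 c ∧ P.le (f x).2 cs) ∧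
      Function.Injective f ∧
      (∀ y : E × E, P.le y.1 c → P.le y.2 cs → ∃ x, f x = y) ∧
      f c = (c, P.zero) ∧
      f P.one = (c, cs) ∧
      (∀ x, P.padd (f x).1 (f x).2 = some x) ∧
      (∀ a b ab, P.padd a b = some ab →
        P.padd (f a).1 (f b).1 = some (f ab).1 ∧
        P.padd (f a).2 (f b).2 = some (f ab).2) ∧
      (∀ a b s t, P.padd (f a).1 (f b).1 = some s → P.le s c →
        P.padd (f a).2 (f b).2 = some t → P.le t cs →
        ∃ ab, P.padd a b = some ab)

/-- The center `Γ(E)`. -/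
def center (P : PartialStruct E) : Set E := {c | P.IsCentral c}

/-- The central interval `Γ(E)[0,c] = Γ(E) ∩ E[0,c]`. -/
def centerIntervalSet (P : PartialStruct E) (c : E) : Set E :=
  {x | P.IsCentral x ∧ P.le x c}

/-- A Γ-orthogonal family: one dominated elementwise by a pairwise
disjoint family of central elements. -/
def GammaOrthogonal (P : PartialStruct E) {I : Type} (e : I → E) : Prop :=
  ∃ c : I → E, (∀ i, P.IsCentral (c i)) ∧
    (∀ i j, i ≠ j → P.IsMeet (c i) (c j) P.zero) ∧
    ∀ i, P.le (e i) (c i)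

/-- Centrally orthocomplete: every Γ-orthogonal family has a supremum. -/
def IsCOPEA (P : PartialStruct E) : Prop :=
  ∀ (I : Type) (e : I → E), P.GammaOrthogonal e → ∃ s, P.IsSup (Set.range e) s

/-- `c` is the central cover of `e`: the smallest central element above `e`. -/
def IsCentralCover (P : PartialStruct E) (c e : E) : Prop :=
  P.IsCentral c ∧ P.le e c ∧ ∀ d, P.IsCentral d → P.le e d → P.le c d

/-- `[Q]`: the set of all suprema of Γ-orthogonal families of elements of `Q`. -/
def bra (P : PartialStruct E) (Q : Set E) : Set E :=
  {s | ∃ (I : Type) (e : I → E), (∀ i, e i ∈ Q) ∧ P.GammaOrthogonal e ∧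
    P.IsSup (Set.range e) s}

/-- `Q^γ = {q ∧ c : q ∈ Q, c ∈ Γ(E)}`. -/
def gammaClosure (P : PartialStruct E) (Q : Set E) : Set E :=
  {m | ∃ q ∈ Q, ∃ c, P.IsCentral c ∧ P.IsMeet q c m}

/-- `Q↓ = ⋃_{q ∈ Q} E[0,q]`. -/
def downSet (P : PartialStruct E) (Q : Set E) : Set E :=
  {e | ∃ q ∈ Q, P.le e q}

/-- `Q' = {e ∈ E : q ∧ e = 0 for all q ∈ Q}`. -/
def commutant (P : PartialStruct E) (Q : Set E) : Set E :=
  {e | ∀ q ∈ Q, P.IsMeet q e P.zero}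

/-- A type-determining (TD) set: `K = [K] = K^γ`. -/
def IsTD (P : PartialStruct E) (K : Set E) : Prop :=
  P.bra K = K ∧ P.gammaClosure K = K

/-- A strongly type-determining (STD) set: `K = [K] = K↓`. -/
def IsSTD (P : PartialStruct E) (K : Set E) : Prop :=
  P.bra K = K ∧ P.downSet K = K

/-- `c` is the type-cover of `K` (w.r.t. the central cover map `γ`):
the unique central element with `γK = Γ(E)[0,c]`. -/
def IsTypeCover (P : PartialStruct E) (γ : E → E) (K : Set E) (c : E) : Prop :=
  P.IsCentral c ∧ γ '' K = P.centerIntervalSet c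

/-- An atom: a nonzero element with no proper nonzero subelement. -/
def IsAtom' (P : PartialStruct E) (a : E) : Prop :=
  a ≠ P.zero ∧ ∀ x, P.le x a → x = P.zero ∨ x = a

end PartialStruct

/-- A PEA-isomorphism between two partial-addition structures: a bijective
morphism whose inverse is a morphism. -/
structure IsPEAIso {A B : Type} (P : PartialStruct A) (Q : PartialStruct B)
    (f : A → B) : Prop where
  bijective : Function.Bijective f
  map_one : f P.one = Q.one
  map_add : ∀ a b ab, P.padd a b = some ab → Q.padd (f a) (f b) = some (f ab)
  rev_add : ∀ a b s, Q.padd (f a) (f b) = some s → ∃ ab, P.padd a b = some ab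

open scoped Classical in
/-- The (coordinatewise) product of a family of partial structures. -/
noncomputable def prodStruct {I : Type} {A : I → Type}
    (Ps : ∀ i, PartialStruct (A i)) : PartialStruct (∀ i, A i) where
  padd a b :=
    if h : ∀ i, ∃ s, (Ps i).padd (a i) (b i) = some s
    then some fun i => Classical.choose (h i)
    else none
  zero := fun i => (Ps i).zero
  one := fun i => (Ps i).one

/-- A pseudo-effect algebra. -/
structure PEA (E : Type) extends PartialStruct E where
  assoc_def : ∀ a b c : E,
    (∃ ab, padd a b = some ab ∧ ∃ x, padd ab c = some x) ↔
    (∃ bc, padd b c = some bc ∧ ∃ y, padd a bc = some y)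
  assoc_eq : ∀ a b c ab bc x y, padd a b = some ab → padd ab c = some x →
    padd b c = some bc → padd a bc = some y → x = y
  exu_right : ∀ a : E, ∃! d, padd a d = some one
  exu_left : ∀ a : E, ∃! e, padd e a = some one
  shift : ∀ a b ab, padd a b = some ab →
    (∃ d, padd d a = some ab) ∧ (∃ e, padd b e = some ab)
  one_add : ∀ a x, padd one a = some x → a = zero
  add_one : ∀ a x, padd a one = some x → a = zero

namespace PEA

variable {E : Type} (P : PEA E)

/-- Shorthand for the underlying partial structure. -/
abbrev ps : PartialStruct E := P.toPartialStruct

theorem one_add_zero : P.padd P.one P.zero = some P.one := by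
  obtain ⟨d, hd, -⟩ := P.exu_right P.one
  have h := P.one_add d P.one hd
  rwa [h] at hd

theorem zero_add_one : P.padd P.zero P.one = some P.one := by
  obtain ⟨e, he, -⟩ := P.exu_left P.one
  have h := P.add_one e P.one he
  rwa [h] at he

theorem padd_zero (a : E) : P.padd a P.zero = some a := by
  obtain ⟨e, he, -⟩ := P.exu_left a
  have h1 : ∃ ab, P.padd e a = some ab ∧ ∃ x, P.padd ab P.zero = some x :=
    ⟨P.one, he, P.one, P.one_add_zero⟩
  obtain ⟨t, ht, y, hy⟩ := (P.assoc_def e a P.zero).mp h1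
  have hxy : P.one = y :=
    P.assoc_eq e a P.zero P.one t P.one y he P.one_add_zero ht hy
  obtain ⟨d, hd, hu⟩ := P.exu_right e
  have hta : t = a := by
    have h2 : t = d := hu t (by rw [← hxy] at hy; exact hy)
    have h3 : a = d := hu a he
    rw [h2, h3]
  rwa [hta] at ht

theorem zero_padd (a : E) : P.padd P.zero a = some a := by
  obtain ⟨d, hd, -⟩ := P.exu_right a
  have h1 : ∃ bc, P.padd a d = some bc ∧ ∃ y, P.padd P.zero bc = some y :=
    ⟨P.one, hd, P.one, P.zero_add_one⟩
  obtain ⟨t, ht, y, hy⟩ := (P.assoc_def P.zero a d).mpr h1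
  have hxy : y = P.one :=
    P.assoc_eq P.zero a d t P.one y P.one ht hy hd P.zero_add_one
  obtain ⟨e, he, hu⟩ := P.exu_left d
  have hta : t = a := by
    have h2 : t = e := hu t (by rw [hxy] at hy; exact hy)
    have h3 : a = e := hu a hd
    rw [h2, h3]
  rwa [hta] at ht

theorem zero_le (a : E) : P.ps.le P.zero a := ⟨a, P.zero_padd a⟩

theorem le_refl (a : E) : P.ps.le a a := ⟨P.zero, P.padd_zero a⟩

open scoped Classical in
/-- The interval pseudo-effect algebra `E[0,p]` as a partial structure on
the subtype `{x // x ≤ p}`; the sum is defined iff it is defined in `E`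
and lies below `p`, and the unit is `p`. -/
noncomputable def intervalStruct (p : E) :
    PartialStruct {x : E // P.ps.le x p} where
  padd a b := (P.padd a.1 b.1).bind fun s =>
    if h : P.ps.le s p then some ⟨s, h⟩ else none
  zero := ⟨P.zero, P.zero_le p⟩
  one := ⟨p, P.le_refl p⟩

end PEA

/-- The order relation of a complete Boolean algebra structure, made explicit. -/
def cbaLe {X : Type} (inst : CompleteBooleanAlgebra X) (a b : X) : Prop :=
  @LE.le X (by letI := inst; exact inferInstance) a b

end PEApaper

namespace PEApaper

namespace PartialStruct

variable {E : Type} (P : PartialStruct E)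

theorem isSumFrom_unique (l : List E) : ∀ {acc s t : E},
    P.IsSumFrom acc l s → P.IsSumFrom acc l t → s = t := by
  induction l with
  | nil => intro acc s t hs ht; exact Eq.trans hs (Eq.symm ht)
  | cons a l ih =>
    rintro acc s t ⟨u, hu, hs⟩ ⟨v, hv, ht⟩
    obtain rfl : u = v := Option.some.inj (hu.symm.trans hv)
    exact ih hs ht

end PartialStruct

namespace PEA

open PartialStruct

variable {E : Type} (P : PEA E)

theorem isSumList_iff_isSumFrom_zero (l : List E) (s : E) :
    P.ps.IsSumList l s ↔ P.ps.IsSumFrom P.zero l s := by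
  cases l with
  | nil => exact Iff.rfl
  | cons a l =>
    refine ⟨fun h => ⟨a, P.zero_padd a, h⟩, ?_⟩
    rintro ⟨t, ht, h⟩
    obtain rfl : a = t := Option.some.inj ((P.zero_padd a).symm.trans ht)
    exact h

theorem isSumFrom_zero_of_isSumList_ofFn {n : ℕ} {g : Fin n → E} {s : E}
    (h : P.ps.IsSumList (List.ofFn g) s) :
    P.ps.IsSumFrom P.zero ((List.finRange n).map g) s := by
  rw [List.ofFn_eq_map] at h
  exact (P.isSumList_iff_isSumFrom_zero _ _).1 h

theorem padd_assoc_left {a b c ab x : E} (h : P.padd a b = some ab)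
    (hx : P.padd ab c = some x) : ∃ bc, P.padd b c = some bc ∧ P.padd a bc = some x := by
  obtain ⟨bc, hbc, y, hy⟩ := (P.assoc_def a b c).1 ⟨ab, h, x, hx⟩
  obtain rfl := P.assoc_eq a b c ab bc x y h hx hbc hy
  exact ⟨bc, hbc, hy⟩

theorem padd_assoc_right {a b c bc x : E} (h : P.padd b c = some bc)
    (hx : P.padd a bc = some x) : ∃ ab, P.padd a b = some ab ∧ P.padd ab c = some x := by
  obtain ⟨ab, hab, y, hy⟩ := (P.assoc_def a b c).2 ⟨bc, h, x, hx⟩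
  obtain rfl := P.assoc_eq a b c ab bc y x hab hy h hx
  exact ⟨ab, hab, hy⟩

theorem eq_zero_of_padd_eq_zero {a b : E} (h : P.padd a b = some P.zero) :
    a = P.zero ∧ b = P.zero := by
  obtain ⟨bc, hbc, -⟩ := P.padd_assoc_left h P.zero_add_one
  have hb := P.add_one b bc hbc
  rw [hb, P.padd_zero] at h
  exact ⟨Option.some.inj h, hb⟩

theorem padd_left_cancel {a b c s : E} (hb : P.padd a b = some s)
    (hc : P.padd a c = some s) : b = c := by
  obtain ⟨e, he, -⟩ := P.exu_left s
  obtain ⟨t, ht, htb⟩ := P.padd_assoc_right hb he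
  obtain ⟨u, hu, huc⟩ := P.padd_assoc_right hc he
  obtain rfl : t = u := Option.some.inj (ht.symm.trans hu)
  exact (P.exu_right t).unique htb huc

/-- `p` behaves as the projection `x ↦ x ∧ c` onto the interval below a central element `c`. -/
structure IsCentralProj (c : E) (p : E → E) : Prop where
  le_center : ∀ x, P.ps.le (p x) c
  padd_rest : ∀ x, ∃ y, P.padd (p x) y = some x ∧ p y = P.zero
  map_padd : ∀ a b ab, P.padd a b = some ab → P.padd (p a) (p b) = some (p ab)
  fix : ∀ x, P.ps.le x c → p x = x
  exchange : ∀ A B S A' B' a b s, P.padd A B = some S → P.padd a b = some s →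
    P.ps.le a c → P.ps.le b c → P.ps.le s c → p A = P.zero → p B = P.zero →
    P.padd A a = some A' → P.padd B b = some B' →
    ∃ S', P.padd S s = some S' ∧ P.padd A' B' = some S'

theorem exists_isCentralProj {c : E} (hc : P.ps.IsCentral c) : ∃ p, P.IsCentralProj c p := by
  obtain ⟨cs, hcs, f, hle, hinj, -, hfc, hf1, hsum, hadd, hrev⟩ := hc
  have hfix : ∀ x, P.ps.le x c → f x = (x, P.zero) := by
    rintro x ⟨y, hy⟩
    have h := (hadd _ _ _ hy).2
    rw [hfc] at h
    have hx := hsum x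
    rw [(P.eq_zero_of_padd_eq_zero h).1] at hx
    exact Prod.ext (Option.some.inj ((P.padd_zero _).symm.trans hx))
      (P.eq_zero_of_padd_eq_zero h).1
  have hpcs : (f cs).1 = P.zero := by
    have h := (hadd _ _ _ hcs).1
    rw [hfc, hf1] at h
    exact P.padd_left_cancel h (P.padd_zero c)
  have hker : ∀ x, (f x).1 = P.zero → f x = (P.zero, x) := by
    intro x hx
    have h := hsum x
    rw [hx] at h
    exact Prod.ext hx (Option.some.inj ((P.zero_padd _).symm.trans h))
  refine ⟨fun x => (f x).1, fun x => (hle x).1, fun x => ⟨(f x).2, hsum x, ?_⟩,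
    fun a b ab h => (hadd a b ab h).1, fun x hx => by rw [hfix x hx], ?_⟩
  · obtain ⟨y, hy⟩ := (hle x).2
    have h := (hadd _ _ _ hy).1
    rw [hpcs] at h
    exact (P.eq_zero_of_padd_eq_zero h).1
  · intro A B S A' B' a b s hAB hab ha hb hs hA hB hA' hB'
    have hS : (f S).1 = P.zero := by
      have h := (hadd _ _ _ hAB).1
      rw [hA, hB, P.zero_padd] at h
      exact (Option.some.inj h).symm
    have hScs : P.ps.le S cs := by
      have h := (hle S).2
      rwa [hker S hS] at h
    have split : ∀ {X x X'}, (f X).1 = P.zero → P.ps.le x c → P.padd X x = some X' →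
        f X' = (x, X) := by
      intro X x X' hX hx h
      have h1 := hadd _ _ _ h
      rw [hker X hX, hfix x hx, P.zero_padd, P.padd_zero] at h1
      exact Prod.ext (Option.some.inj h1.1).symm (Option.some.inj h1.2).symm
    have hfA' := split hA ha hA'
    have hfB' := split hB hb hB'
    obtain ⟨S', hS'⟩ := hrev S s s S (by rw [hker S hS, hfix s hs, P.zero_padd]) hs
      (by rw [hker S hS, hfix s hs, P.padd_zero]) hScs
    obtain ⟨T, hT⟩ := hrev A' B' s S (by rw [hfA', hfB', hab]) hs
      (by rw [hfA', hfB', hAB]) hScs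
    have hfT : f T = (s, S) := by
      have h := hadd _ _ _ hT
      rw [hfA', hfB', hab, hAB] at h
      exact Prod.ext (Option.some.inj h.1).symm (Option.some.inj h.2).symm
    obtain rfl : T = S' := hinj (hfT.trans (split hS hs hS').symm)
    exact ⟨T, hS', hT⟩

namespace IsCentralProj

variable {P} {c : E} {p : E → E}

theorem map_zero (h : P.IsCentralProj c p) : p P.zero = P.zero :=
  h.fix _ (P.zero_le c)

theorem eq_zero_of_le (h : P.IsCentralProj c p) {x y : E} (hxy : P.ps.le x y)
    (hy : p y = P.zero) : p x = P.zero := by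
  obtain ⟨z, hz⟩ := hxy
  have hz' := h.map_padd _ _ _ hz
  rw [hy] at hz'
  exact (P.eq_zero_of_padd_eq_zero hz').1

theorem le_self (h : P.IsCentralProj c p) (x : E) : P.ps.le (p x) x :=
  (h.padd_rest x).imp fun _ hy => hy.1

theorem isMeet (h : P.IsCentralProj c p) (x : E) : P.ps.IsMeet x c (p x) := by
  refine ⟨h.le_self x, h.le_center x, ?_⟩
  rintro y ⟨z, hz⟩ hyc
  have hy := h.map_padd _ _ _ hz
  rw [h.fix y hyc] at hy
  exact ⟨p z, hy⟩

theorem eq_zero_of_le_of_disjoint (h : P.IsCentralProj c p) {d x : E}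
    (hd : P.ps.IsMeet c d P.zero) (hx : P.ps.le x d) : p x = P.zero := by
  obtain ⟨y, hy⟩ := hd.2.2 (p d) (h.le_center d) (h.le_self d)
  exact h.eq_zero_of_le hx (P.eq_zero_of_padd_eq_zero hy).1

end IsCentralProj

section Family

variable {P} {I : Type} {c : I → E} {p : I → E → E}

theorem proj_isSumFrom_of_notMem (hp : ∀ i, P.IsCentralProj (c i) (p i))
    (hdisj : ∀ i j, i ≠ j → P.ps.IsMeet (c i) (c j) P.zero) {e : I → E}
    (he : ∀ i, P.ps.le (e i) (c i)) (k : I) (L : List I) :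
    ∀ {A s : E}, k ∉ L → P.ps.IsSumFrom A (L.map e) s → p k s = p k A := by
  induction L with
  | nil => intro A s _ hs; exact congrArg (p k) hs
  | cons i L ih =>
    rintro A s hk ⟨t, ht, hs⟩
    rw [List.mem_cons, not_or] at hk
    have hpt := (hp k).map_padd _ _ _ ht
    rw [(hp k).eq_zero_of_le_of_disjoint (hdisj k i hk.1) (he i), P.padd_zero] at hpt
    exact (ih hk.2 hs).trans (Option.some.inj hpt).symm

theorem proj_isSumFrom (hp : ∀ i, P.IsCentralProj (c i) (p i))
    (hdisj : ∀ i j, i ≠ j → P.ps.IsMeet (c i) (c j) P.zero) {e : I → E}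
    (he : ∀ i, P.ps.le (e i) (c i)) (k : I) (L : List I) :
    ∀ {A s : E}, L.Nodup → k ∈ L → p k A = P.zero → P.ps.IsSumFrom A (L.map e) s →
      p k s = e k := by
  induction L with
  | nil => intro A s _ hk; cases hk
  | cons i L ih =>
    rintro A s hL hk hA ⟨t, ht, hs⟩
    rw [List.nodup_cons] at hL
    have hpt := (hp k).map_padd _ _ _ ht
    rw [hA, P.zero_padd] at hpt
    by_cases hki : k = i
    · subst hki
      rw [(hp k).fix _ (he k)] at hpt
      exact (proj_isSumFrom_of_notMem hp hdisj he k L hL.1 hs).trans (Option.some.inj hpt).symm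
    · rw [(hp k).eq_zero_of_le_of_disjoint (hdisj k i hki) (he i)] at hpt
      exact ih hL.2 ((List.mem_cons.1 hk).resolve_left hki) (Option.some.inj hpt).symm hs

theorem isSumFrom_padd (hp : ∀ i, P.IsCentralProj (c i) (p i))
    (hdisj : ∀ i j, i ≠ j → P.ps.IsMeet (c i) (c j) P.zero) {a b s : I → E}
    (ha : ∀ i, P.ps.le (a i) (c i)) (hb : ∀ i, P.ps.le (b i) (c i))
    (hs : ∀ i, P.ps.le (s i) (c i)) (hab : ∀ i, P.padd (a i) (b i) = some (s i))
    (L : List I) :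
    ∀ {A B S A' B' : E}, L.Nodup → (∀ i ∈ L, p i A = P.zero) → (∀ i ∈ L, p i B = P.zero) →
      P.padd A B = some S → P.ps.IsSumFrom A (L.map a) A' → P.ps.IsSumFrom B (L.map b) B' →
      ∃ S', P.ps.IsSumFrom S (L.map s) S' ∧ P.padd A' B' = some S' := by
  induction L with
  | nil =>
    rintro A B S A' B' - - - hAB rfl rfl
    exact ⟨S, rfl, hAB⟩
  | cons i L ih =>
    rintro A B S A' B' hL hA hB hAB ⟨A₁, hA₁, hA'⟩ ⟨B₁, hB₁, hB'⟩
    rw [List.nodup_cons] at hL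
    obtain ⟨S₁, hS₁, hAB₁⟩ := (hp i).exchange A B S A₁ B₁ (a i) (b i) (s i) hAB (hab i)
      (ha i) (hb i) (hs i) (hA i List.mem_cons_self) (hB i List.mem_cons_self) hA₁ hB₁
    have vanish : ∀ {X X₁ x}, (∀ j ∈ i :: L, p j X = P.zero) → P.ps.le x (c i) →
        P.padd X x = some X₁ → ∀ j ∈ L, p j X₁ = P.zero := by
      intro X X₁ x hX hx h j hj
      have h' := (hp j).map_padd _ _ _ h
      have hji : j ≠ i := fun hji => hL.1 (hji ▸ hj)
      rw [hX j (List.mem_cons_of_mem i hj), P.zero_padd,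
        (hp j).eq_zero_of_le_of_disjoint (hdisj j i hji) hx] at h'
      exact (Option.some.inj h').symm
    obtain ⟨S', hS', hAB'⟩ := ih hL.2 (vanish hA (ha i) hA₁) (vanish hB (hb i) hB₁) hAB₁ hA' hB'
    exact ⟨S', ⟨S₁, hS₁, hS'⟩, hAB'⟩

theorem exists_isSumFrom_proj (hp : ∀ i, P.IsCentralProj (c i) (p i))
    (hdisj : ∀ i j, i ≠ j → P.ps.IsMeet (c i) (c j) P.zero) (x : E) (L : List I) :
    ∀ {A r : E}, L.Nodup → (∀ i ∈ L, p i A = P.zero) → P.padd A r = some x →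
      ∃ A' r', P.ps.IsSumFrom A (L.map fun i => p i x) A' ∧ P.padd A' r' = some x ∧
        (∀ i ∈ L, p i r' = P.zero) ∧ ∀ j, p j r = P.zero → p j r' = P.zero := by
  induction L with
  | nil =>
    intro A r _ _ h
    exact ⟨A, r, rfl, h, by simp, fun _ h => h⟩
  | cons i L ih =>
    intro A r hL hA h
    rw [List.nodup_cons] at hL
    have hpr := (hp i).map_padd _ _ _ h
    rw [hA i List.mem_cons_self, P.zero_padd] at hpr
    obtain ⟨r₁, hr₁, hir₁⟩ := (hp i).padd_rest r
    obtain ⟨A₁, hA₁, h₁⟩ := P.padd_assoc_right hr₁ h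
    rw [Option.some.inj hpr] at hA₁
    obtain ⟨A', r', hA', hx, hr', hpres⟩ := ih hL.2 (A := A₁) (r := r₁) (by
      intro j hj
      have h' := (hp j).map_padd _ _ _ hA₁
      have hji : j ≠ i := fun hji => hL.1 (hji ▸ hj)
      rw [hA j (List.mem_cons_of_mem i hj), P.zero_padd,
        (hp j).eq_zero_of_le_of_disjoint (hdisj j i hji) ((hp i).le_center x)] at h'
      exact (Option.some.inj h').symm) h₁
    refine ⟨A', r', ⟨A₁, hA₁, hA'⟩, hx, ?_, ?_⟩
    · intro j hj
      rcases List.mem_cons.1 hj with rfl | hj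
      · exact hpres j hir₁
      · exact hr' j hj
    · intro j hj
      apply hpres
      have h' := (hp j).map_padd _ _ _ hr₁
      rw [hj] at h'
      exact (P.eq_zero_of_padd_eq_zero h').2

theorem isSumFrom_map_zero (x : E) (L : List I) :
    P.ps.IsSumFrom x (L.map fun _ => P.zero) x := by
  induction L with
  | nil => rfl
  | cons i L ih => exact ⟨x, P.padd_zero x, ih⟩

theorem eq_zero_of_forall_proj_eq_zero (hp : ∀ i, P.IsCentralProj (c i) (p i))
    (hdisj : ∀ i j, i ≠ j → P.ps.IsMeet (c i) (c j) P.zero) {L : List I} (hL : L.Nodup)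
    (hone : P.ps.IsSumFrom P.zero (L.map c) P.one) {x : E} (hx : ∀ i ∈ L, p i x = P.zero) :
    x = P.zero := by
  obtain ⟨S, -, hS⟩ := isSumFrom_padd hp hdisj (fun i => P.le_refl (c i))
    (fun i => P.zero_le (c i)) (fun i => P.le_refl (c i)) (fun i => P.padd_zero (c i)) L hL
    (fun i _ => (hp i).map_zero) hx (P.zero_padd x) hone (isSumFrom_map_zero x L)
  exact P.one_add x S hS

theorem isSumFrom_proj (hp : ∀ i, P.IsCentralProj (c i) (p i))
    (hdisj : ∀ i j, i ≠ j → P.ps.IsMeet (c i) (c j) P.zero) {L : List I} (hL : L.Nodup)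
    (hone : P.ps.IsSumFrom P.zero (L.map c) P.one) (x : E) :
    P.ps.IsSumFrom P.zero (L.map fun i => p i x) x := by
  obtain ⟨A, r, hA, hx, hr, -⟩ := exists_isSumFrom_proj hp hdisj x L hL
    (fun i _ => (hp i).map_zero) (P.zero_padd x)
  rw [eq_zero_of_forall_proj_eq_zero hp hdisj hL hone hr, P.padd_zero] at hx
  rwa [Option.some.inj hx] at hA

end Family

theorem intervalStruct_padd_eq_some {q : E} {a b s : {x : E // P.ps.le x q}} :
    (P.intervalStruct q).padd a b = some s ↔ P.padd a.1 b.1 = some s.1 := by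
  simp only [intervalStruct, Option.bind_eq_some_iff]
  constructor
  · rintro ⟨t, ht, h⟩
    split_ifs at h with hle
    rw [← Option.some.inj h]
    exact ht
  · intro h
    exact ⟨s.1, h, dif_pos s.2⟩

end PEA

theorem prodStruct_padd_eq_some {I : Type} {A : I → Type} {Ps : ∀ i, PartialStruct (A i)}
    {a b s : ∀ i, A i} :
    (prodStruct Ps).padd a b = some s ↔ ∀ i, (Ps i).padd (a i) (b i) = some (s i) := by
  simp only [prodStruct]
  constructor
  · intro h i
    split_ifs at h with hex
    rw [← Option.some.inj h]
    exact Classical.choose_spec (hex i)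
  · intro h
    have hex : ∀ i, ∃ t, (Ps i).padd (a i) (b i) = some t := fun i => ⟨s i, h i⟩
    rw [dif_pos hex]
    congr 1
    funext i
    exact Option.some.inj ((Classical.choose_spec (hex i)).symm.trans (h i))

end PEApaper

open PEApaper PEApaper.PartialStruct in
/-- Theorem 3.7: if `c₁,…,cₙ` are pairwise disjoint central elements with
`c₁ + ⋯ + cₙ = 1`, then `Φ(e₁,…,eₙ) := e₁ + ⋯ + eₙ` is a PEA-isomorphism of
`E[0,c₁] × ⋯ × E[0,cₙ]` onto `E`, and `Φ⁻¹(e) = (e ∧ c₁, …, e ∧ cₙ)`. -/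
theorem stmt0 {E : Type} (P : PEA E) (n : ℕ) (c : Fin n → E)
    (hc : ∀ i, P.ps.IsCentral (c i))
    (hdisj : ∀ i j, i ≠ j → P.ps.IsMeet (c i) (c j) P.ps.zero)
    (hsum : P.ps.IsSumList (List.ofFn c) P.ps.one)
    (Φ : (∀ i, {x : E // P.ps.le x (c i)}) → E)
    (hΦ : ∀ e, P.ps.IsSumList (List.ofFn fun i => (e i).1) (Φ e)) :
    IsPEAIso (prodStruct fun i => P.intervalStruct (c i)) P.ps Φ ∧
      ∀ (x : E) (e : ∀ i, {y : E // P.ps.le y (c i)}),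
        Φ e = x → ∀ i, P.ps.IsMeet x (c i) (e i).1 := by
  have hdisj' : ∀ i j, i ≠ j → P.ps.IsMeet (c i) (c j) P.zero := hdisj
  choose p hp using fun i => P.exists_isCentralProj (hc i)
  have hL := List.nodup_finRange n
  have hmem : ∀ i : Fin n, i ∈ List.finRange n := List.mem_finRange
  have hone := P.isSumFrom_zero_of_isSumList_ofFn hsum
  have hΦ' := fun e => P.isSumFrom_zero_of_isSumList_ofFn (hΦ e)
  have hcoord : ∀ e i, p i (Φ e) = (e i).1 := fun e i =>
    PEA.proj_isSumFrom hp hdisj' (fun j => (e j).2) i _ hL (hmem i) (hp i).map_zero (hΦ' e)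
  refine ⟨⟨⟨?_, ?_⟩, ?_, ?_, ?_⟩, ?_⟩
  · intro a b hab
    funext i
    apply Subtype.ext
    rw [← hcoord a i, ← hcoord b i, hab]
  · intro x
    exact ⟨fun i => ⟨p i x, (hp i).le_center x⟩,
      isSumFrom_unique _ _ (hΦ' _) (PEA.isSumFrom_proj hp hdisj' hL hone x)⟩
  · exact isSumFrom_unique _ _ (hΦ' _) hone
  · intro a b s hs
    have hs' := fun i => P.intervalStruct_padd_eq_some.1 (prodStruct_padd_eq_some.1 hs i)
    obtain ⟨S, hS, hadd⟩ := PEA.isSumFrom_padd hp hdisj' (fun i => (a i).2) (fun i => (b i).2)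
      (fun i => (s i).2) hs' _ hL (fun i _ => (hp i).map_zero) (fun i _ => (hp i).map_zero)
      (P.zero_padd P.zero) (hΦ' a) (hΦ' b)
    rwa [isSumFrom_unique _ _ hS (hΦ' s)] at hadd
  · intro a b s hs
    refine ⟨fun i => ⟨p i s, (hp i).le_center s⟩, prodStruct_padd_eq_some.2 fun i =>
      P.intervalStruct_padd_eq_some.2 ?_⟩
    rw [← hcoord a i, ← hcoord b i]
    exact (hp i).map_padd _ _ _ hs
  · rintro x e rfl i
    rw [← hcoord e i]
    exact (hp i).isMeet _
end

section
/- Let E be a pseudo-effect algebra and φ : E → E a map satisfying, for all e,f ∈ E: if φ(e)+f exists then e+φ(f) exists, and if f+φ(e) exists then φ(f)+e exists. Then (i) φ is order preserving, and (ii) if (eᵢ)_{i∈I} ⊆ E and e := ⋁_{i∈I} eᵢ exists in E, then ⋁_{i∈I} φ(eᵢ) exists in E and φ(e) = ⋁_{i∈I} φ(eᵢ). -/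
namespace PEApaper.PEA

variable {E : Type} (P : PEA E)

theorem le_trans {a b c : E} (hab : P.ps.le a b) (hbc : P.ps.le b c) : P.ps.le a c := by
  obtain ⟨u, hu⟩ := hab
  obtain ⟨v, hv⟩ := hbc
  obtain ⟨w, hw, y, hy⟩ := (P.assoc_def a u v).mp ⟨b, hu, c, hv⟩
  rw [P.assoc_eq a u v b w c y hu hv hw hy]
  exact ⟨w, hy⟩

theorem le_one (a : E) : P.ps.le a P.one := (P.exu_right a).exists

/-- If `g = f⁻`, then `a + f` exists iff `a ≤ g`. -/
theorem exists_padd_iff_le {f g : E} (hgf : P.padd g f = some P.one) (a : E) :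
    (∃ x, P.padd a f = some x) ↔ P.ps.le a g := by
  constructor
  · rintro ⟨x, hx⟩
    obtain ⟨y, hy⟩ := P.le_one x
    obtain ⟨t, ht, z, hz⟩ := (P.assoc_def a f y).mp ⟨x, hx, P.one, hy⟩
    have hz1 := P.assoc_eq a f y x t P.one z hx hy ht hz
    obtain ⟨y', hy'⟩ := (P.shift f y t ht).1
    obtain ⟨r, hr, w, hw⟩ := (P.assoc_def a y' f).mpr ⟨t, hy', z, hz⟩
    have hw1 := P.assoc_eq a y' f r t w z hr hw hy' hz
    have hrg : r = g := (P.exu_left f).unique (by rw [hw, hw1, hz1]) hgf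
    exact ⟨y', by rw [hr, hrg]⟩
  · rintro ⟨c, hc⟩
    obtain ⟨t, ht, z, hz⟩ := (P.assoc_def a c f).mp ⟨g, hc, P.one, hgf⟩
    obtain ⟨c', hc'⟩ := (P.shift c f t ht).2
    obtain ⟨x, hx, -⟩ := (P.assoc_def a f c').mpr ⟨t, hc', z, hz⟩
    exact ⟨x, hx⟩

end PEApaper.PEA

open PEApaper PEApaper.PartialStruct in
/-- Lemma 3.10: if `φ : E → E` satisfies `φ(e)+f` exists ⟹ `e+φ(f)` exists and
`f+φ(e)` exists ⟹ `φ(f)+e` exists, then φ is order preserving and preserves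
all existing suprema. -/
theorem stmt2 {E : Type} (P : PEA E) (φ : E → E)
    (h1 : ∀ e f x, P.ps.padd (φ e) f = some x → ∃ y, P.ps.padd e (φ f) = some y)
    (h2 : ∀ e f x, P.ps.padd f (φ e) = some x → ∃ y, P.ps.padd (φ f) e = some y) :
    (∀ a b, P.ps.le a b → P.ps.le (φ a) (φ b)) ∧
    (∀ (I : Type) (e : I → E) (s : E), P.ps.IsSup (Set.range e) s →
      P.ps.IsSup (Set.range fun i => φ (e i)) (φ s)) := by
  have adj : ∀ {d g k : E}, P.padd g d = some P.one → P.padd k (φ d) = some P.one →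
      ∀ a, P.ps.le (φ a) g ↔ P.ps.le a k := by
    intro d g k hg hk a
    rw [← P.exists_padd_iff_le hg, ← P.exists_padd_iff_le hk]
    exact ⟨fun ⟨x, hx⟩ => h1 a d x hx, fun ⟨x, hx⟩ => h2 d a x hx⟩
  have mono : ∀ a b, P.ps.le a b → P.ps.le (φ a) (φ b) := by
    intro a b hab
    obtain ⟨d, hd⟩ := P.le_one (φ b)
    obtain ⟨k, hk⟩ := (P.exu_left (φ d)).exists
    exact (adj hd hk a).mpr (P.le_trans hab ((adj hd hk b).mp (P.le_refl _)))
  refine ⟨mono, fun I e s hs => ⟨?_, fun u hu => ?_⟩⟩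
  · rintro _ ⟨i, rfl⟩
    exact mono _ _ (hs.1 _ ⟨i, rfl⟩)
  · obtain ⟨d, hd⟩ := P.le_one u
    obtain ⟨k, hk⟩ := (P.exu_left (φ d)).exists
    refine (adj hd hk s).mpr (hs.2 k ?_)
    rintro _ ⟨i, rfl⟩
    exact (adj hd hk _).mp (hu _ ⟨i, rfl⟩)
end
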